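/- arXiv:1307.1056 — 2 statements merged into one kernel-verified Lean document; each statement's English description precedes it below -/
import Mathlib

section
/- Let O ⊆ ℝ^n be open and bounded, T > 0, and let X : O̅ × [0,T] → ℝ^{n+1} be C² such that the metric matrix g(θ,t) = (g_{ij}(θ,t)) with g_{ij} := ∂_{θ_i}X · ∂_{θ_j}X is positive definite for every (θ,t); let (g^{ij}) denote its inverse. Let U : O̅ × [0,T] → ℝ be C¹. Then the function t ↦ ∫_O U(θ,t) √(det g(θ,t)) dθ is differentiable on [0,T] and d/dt ∫_O U √(det g) dθ = ∫_O ( ∂_t U + U · Σ_{i,j} g^{ij} (∂_t ∂_{θ_i}X) · (∂_{θ_j}X) ) √(det g) dθ. -/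
open scoped BigOperators

/-- Partial derivative in the parameter direction `θ_i`, taken within the set `S`,
for a scalar function of `(θ, t) ∈ ℝ^n × ℝ`. -/
noncomputable def dtheta {n : ℕ} (S : Set ((Fin n → ℝ) × ℝ)) (W : (Fin n → ℝ) × ℝ → ℝ)
    (i : Fin n) (p : (Fin n → ℝ) × ℝ) : ℝ :=
  fderivWithin ℝ W S p (Pi.single i 1, 0)

/-- Partial derivative in the time direction, taken within the set `S`. -/
noncomputable def dtime {n : ℕ} (S : Set ((Fin n → ℝ) × ℝ)) (W : (Fin n → ℝ) × ℝ → ℝ)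
    (p : (Fin n → ℝ) × ℝ) : ℝ :=
  fderivWithin ℝ W S p (0, 1)

/-- Induced metric `g_{ij} = ∂_{θ_i} X · ∂_{θ_j} X` of a parametrized moving surface. -/
noncomputable def metricMat {n : ℕ} (S : Set ((Fin n → ℝ) × ℝ))
    (X : (Fin n → ℝ) × ℝ → Fin (n + 1) → ℝ) (p : (Fin n → ℝ) × ℝ) :
    Matrix (Fin n) (Fin n) ℝ :=
  Matrix.of fun i j => ∑ l, dtheta S (fun q => X q l) i p * dtheta S (fun q => X q l) j p

open Set Filter Topology MeasureTheory
open scoped Matrix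

theorem hasDerivWithinAt_integral_of_norm_deriv_le {α E : Type*} [MeasurableSpace α]
    [NormedAddCommGroup E] [NormedSpace ℝ E] {μ : Measure α} {f f' : α → ℝ → E}
    {s : Set ℝ} (hs : Convex ℝ s) {t : ℝ} (ht : t ∈ s) {bound : α → ℝ}
    (hbound : Integrable bound μ) (hint : ∀ r ∈ s, Integrable (fun a => f a r) μ)
    (hderiv : ∀ᵐ a ∂μ, ∀ r ∈ s, HasDerivWithinAt (f a) (f' a r) s r)
    (hle : ∀ᵐ a ∂μ, ∀ r ∈ s, ‖f' a r‖ ≤ bound a) :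
    HasDerivWithinAt (fun r => ∫ a, f a r ∂μ) (∫ a, f' a t ∂μ) s t := by
  rw [hasDerivWithinAt_iff_tendsto_slope]
  have hmem : ∀ᶠ r in 𝓝[s \ {t}] t, r ∈ s \ {t} := self_mem_nhdsWithin
  have hslope : ∀ᶠ r in 𝓝[s \ {t}] t,
      ∫ a, slope (f a) t r ∂μ = slope (fun r => ∫ a, f a r ∂μ) t r := by
    filter_upwards [hmem] with r hr
    simp only [slope_def_module]
    rw [integral_smul, integral_sub (hint r hr.1) (hint t ht)]
  refine Tendsto.congr' hslope ?_
  refine tendsto_integral_filter_of_dominated_convergence bound ?_ ?_ hbound ?_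
  · filter_upwards [hmem] with r hr
    simp only [slope_def_module]
    exact (((hint r hr.1).sub (hint t ht)).smul (r - t)⁻¹).aestronglyMeasurable
  · filter_upwards [hmem] with r hr
    filter_upwards [hderiv, hle] with a hd hb
    have h := hs.norm_image_sub_le_of_norm_hasDerivWithin_le hd hb ht hr.1
    have hne : 0 < ‖r - t‖ := norm_pos_iff.2 (sub_ne_zero.2 hr.2)
    rw [slope_def_module, norm_smul, norm_inv, inv_mul_le_iff₀ hne, mul_comm]
    exact h
  · filter_upwards [hderiv] with a hd
    exact hasDerivWithinAt_iff_tendsto_slope.1 (hd t ht)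

theorem ContDiffOn.exists_norm_iteratedFDerivWithin_le {E F : Type*} [NormedAddCommGroup E]
    [NormedSpace ℝ E] [NormedAddCommGroup F] [NormedSpace ℝ F] {f : E → F} {S K : Set E} {m : ℕ}
    (hf : ContDiffOn ℝ m f S) (hS : IsCompact S) (hKS : K ⊆ S) (hK : UniqueDiffOn ℝ K) :
    ∃ C : ℝ, ∀ p ∈ K, ‖iteratedFDerivWithin ℝ m f K p‖ ≤ C := by
  suffices h : ∃ C : ℝ, ∀ p ∈ S ∩ K, ‖iteratedFDerivWithin ℝ m f K p‖ ≤ C from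
    h.imp fun C hC p hp => hC p ⟨hKS hp, hp⟩
  refine hS.induction_on (p := fun V => ∃ C : ℝ, ∀ p ∈ V ∩ K,
    ‖iteratedFDerivWithin ℝ m f K p‖ ≤ C) ⟨0, by simp⟩ ?_ ?_ ?_
  · rintro V W hVW ⟨C, hC⟩
    exact ⟨C, fun p hp => hC p ⟨hVW hp.1, hp.2⟩⟩
  · rintro V W ⟨C, hC⟩ ⟨D, hD⟩
    refine ⟨max C D, fun p hp => ?_⟩
    rcases hp.1 with h | h
    · exact (hC p ⟨h, hp.2⟩).trans (le_max_left _ _)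
    · exact (hD p ⟨h, hp.2⟩).trans (le_max_right _ _)
  · intro x hx
    obtain ⟨u, hu, P, hP⟩ := (hf x hx) m le_rfl
    rw [insert_eq_of_mem hx] at hu
    have hcont := (hP.cont m le_rfl).norm x (mem_of_mem_nhdsWithin hx hu)
    have hlt : ∀ᶠ y in 𝓝[S] x, ‖P y m‖ < ‖P x m‖ + 1 :=
      nhdsWithin_le_of_mem hu (hcont.eventually (gt_mem_nhds (lt_add_one _)))
    obtain ⟨v, hvo, hxv, hv⟩ := mem_nhdsWithin.1 (inter_mem hu hlt)
    refine ⟨v ∩ S, Filter.inter_mem (mem_nhdsWithin_of_mem_nhds (hvo.mem_nhds hxv)) self_mem_nhdsWithin, ‖P x m‖ + 1, ?_⟩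
    rintro p ⟨⟨hpv, hpS⟩, hpK⟩
    have hT : HasFTaylorSeriesUpToOn m f P (K ∩ v) :=
      hP.mono fun q hq => (hv ⟨hq.2, hKS hq.1⟩).1
    rw [← iteratedFDerivWithin_inter_open hvo hpv,
      ← hT.eq_iteratedFDerivWithin_of_uniqueDiffOn le_rfl (hK.inter hvo) ⟨hpK, hpv⟩]
    exact (hv ⟨hpv, hpS⟩).2.le

namespace Matrix

theorem sum_mul_sum_transpose {ι κ : Type*} [Fintype ι] [Fintype κ]
    (G : Matrix ι ι ℝ) (A B : Matrix ι κ ℝ) :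
    ∑ i, ∑ j, G i j * ∑ l, B i l * A j l = (Gᵀ * (B * Aᵀ)).trace := by
  simp only [trace, diag_apply, mul_apply, transpose_apply]
  rw [Finset.sum_comm]

theorem hasDerivWithinAt_det {ι : Type*} [Fintype ι] [DecidableEq ι] {M : ℝ → Matrix ι ι ℝ}
    {M' : Matrix ι ι ℝ} {s : Set ℝ} {t : ℝ}
    (hM : ∀ i j, HasDerivWithinAt (fun r => M r i j) (M' i j) s t) :
    HasDerivWithinAt (fun r => (M r).det) ((M t).adjugate * M').trace s t := by
  let D : ContinuousMultilinearMap ℝ (fun _ : ι => ι → ℝ) ℝ :=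
    { (detRowAlternating (R := ℝ) (n := ι)).toMultilinearMap with
      cont := Continuous.matrix_det (A := fun M : ι → ι → ℝ => (of M : Matrix ι ι ℝ)) continuous_id }
  have hM' : HasDerivWithinAt (fun r => (M r : ι → ι → ℝ)) M' s t :=
    hasDerivWithinAt_pi.2 fun i => hasDerivWithinAt_pi.2 fun j => hM i j
  have h := (D.hasFDerivAt (M t)).comp_hasDerivWithinAt t hM'
  suffices hD : D.linearDeriv (M t) M' = ((M t).adjugate * M').trace from hD ▸ h
  rw [trace_mul_comm]
  refine (ContinuousMultilinearMap.linearDeriv_apply D (M t : ι → ι → ℝ) M').trans ?_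
  refine Finset.sum_congr rfl fun i _ => ?_
  have h1 : D (Function.update (M t) i (M' i)) = ((M t).updateRow i (M' i)).det := rfl
  rw [h1, ← cramer_transpose_apply, cramer_eq_adjugate_mulVec, ← adjugate_transpose]
  simp [diag_apply, mul_apply, mulVec, dotProduct, mul_comm]

theorem hasDerivWithinAt_sqrt_det_mul_transpose {ι κ : Type*} [Fintype ι] [Fintype κ]
    [DecidableEq ι] {A : ℝ → Matrix ι κ ℝ} {A' : Matrix ι κ ℝ} {s : Set ℝ} {t : ℝ}
    (hA : ∀ i l, HasDerivWithinAt (fun r => A r i l) (A' i l) s t)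
    (hdet : 0 < (A t * (A t)ᵀ).det) :
    HasDerivWithinAt (fun r => √(A r * (A r)ᵀ).det)
      ((∑ i, ∑ j, (A t * (A t)ᵀ)⁻¹ i j * ∑ l, A' i l * A t j l) * √(A t * (A t)ᵀ).det) s t := by
  have hM : ∀ i j, HasDerivWithinAt (fun r => (A r * (A r)ᵀ) i j)
      ((A' * (A t)ᵀ + A t * A'ᵀ) i j) s t := by
    intro i j
    simp only [mul_apply, add_apply, transpose_apply, ← Finset.sum_add_distrib]
    exact HasDerivWithinAt.fun_sum fun l _ => (hA i l).mul (hA j l)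
  have hsymm : (A t * (A t)ᵀ)ᵀ = A t * (A t)ᵀ := by simp
  have h := (hasDerivWithinAt_det hM).sqrt hdet.ne'
  convert h using 1
  rw [sum_mul_sum_transpose, transpose_nonsing_inv, hsymm, inv_def, Ring.inverse_eq_inv']
  have htr : ((A t * (A t)ᵀ).adjugate * (A t * A'ᵀ)).trace
      = ((A t * (A t)ᵀ).adjugate * (A' * (A t)ᵀ)).trace := by
    rw [← trace_transpose, transpose_mul, adjugate_transpose, hsymm, trace_mul_comm]
    simp
  rw [mul_add, trace_add, htr, smul_mul, trace_smul, smul_eq_mul]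
  have hs := Real.sq_sqrt hdet.le
  have hs0 := (Real.sqrt_pos.2 hdet).ne'
  field_simp
  rw [hs]
  ring

theorem abs_sum_inv_mul_sqrt_det_le {ι κ : Type*} [Fintype ι] [Fintype κ]
    [DecidableEq ι] (A B : Matrix ι κ ℝ) (hdet : 0 < (A * Aᵀ).det) :
    |(∑ i, ∑ j, (A * Aᵀ)⁻¹ i j * ∑ l, B i l * A j l) * √(A * Aᵀ).det|
      ≤ √((∑ i, ∑ l, B i l ^ 2) * (A * Aᵀ).adjugate.trace) := by
  have hsymm : (A * Aᵀ)ᵀ = A * Aᵀ := by simp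
  have hunit : IsUnit (A * Aᵀ).det := hdet.ne'.isUnit
  have h1 : ∑ i, ∑ j, (A * Aᵀ)⁻¹ i j * ∑ l, B i l * A j l
      = ∑ x : ι × κ, B x.1 x.2 * ((A * Aᵀ)⁻¹ * A) x.1 x.2 := by
    rw [Fintype.sum_prod_type]
    refine Finset.sum_congr rfl fun i _ => ?_
    simp only [mul_apply (N := A), Finset.mul_sum]
    rw [Finset.sum_comm]
    exact Finset.sum_congr rfl fun _ _ => Finset.sum_congr rfl fun _ _ => by ring
  have h2 : ∑ x : ι × κ, ((A * Aᵀ)⁻¹ * A) x.1 x.2 ^ 2 = ((A * Aᵀ)⁻¹).trace := by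
    have : ((A * Aᵀ)⁻¹ * A) * ((A * Aᵀ)⁻¹ * A)ᵀ = (A * Aᵀ)⁻¹ := by
      rw [transpose_mul, transpose_nonsing_inv, hsymm, Matrix.mul_assoc, ← Matrix.mul_assoc A,
        mul_nonsing_inv _ hunit, mul_one]
    rw [← congrArg trace this, Fintype.sum_prod_type]
    simp only [trace, diag_apply, mul_apply (M := (A * Aᵀ)⁻¹ * A), transpose_apply, sq]
  have h3 : (A * Aᵀ).adjugate.trace = (A * Aᵀ).det * ((A * Aᵀ)⁻¹).trace := by
    rw [inv_def, trace_smul, Ring.inverse_eq_inv', smul_eq_mul, mul_inv_cancel_left₀ hdet.ne']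
  refine Real.abs_le_sqrt ?_
  rw [mul_pow, Real.sq_sqrt hdet.le, h1, h3, ← h2, ← Fintype.sum_prod_type
    (f := fun x : ι × κ => B x.1 x.2 ^ 2)]
  have := Finset.sum_mul_sq_le_sq_mul_sq Finset.univ (fun x : ι × κ => B x.1 x.2)
    (fun x => ((A * Aᵀ)⁻¹ * A) x.1 x.2)
  nlinarith

theorem exists_abs_le_of_continuous {ι κ : Type*} [Fintype ι] [Fintype κ]
    {φ : Matrix ι κ ℝ → ℝ} (hφ : Continuous φ) (C : ℝ) :
    ∃ D, ∀ A : Matrix ι κ ℝ, (∀ i l, |A i l| ≤ C) → |φ A| ≤ D := by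
  have hc : IsCompact (univ.pi fun _ : ι => univ.pi fun _ : κ => Icc (-C) C) :=
    isCompact_univ_pi fun _ => isCompact_univ_pi fun _ => isCompact_Icc
  obtain ⟨D, hD⟩ := hc.exists_bound_of_continuousOn (f := φ) hφ.continuousOn
  exact ⟨D, fun A hA => hD A fun i _ l _ => abs_le.1 (hA i l)⟩

end Matrix

section Slice

variable {n : ℕ} {O : Set (Fin n → ℝ)} {S K : Set ((Fin n → ℝ) × ℝ)}

theorem dtheta_eq_of_eventuallyEq {W : (Fin n → ℝ) × ℝ → ℝ} {i : Fin n} {p : (Fin n → ℝ) × ℝ}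
    (h : S =ᶠ[𝓝 p] K) : dtheta S W i p = dtheta K W i p := by
  rw [dtheta, dtheta, fderivWithin_congr_set h]

theorem dtime_eq_of_eventuallyEq {V W : (Fin n → ℝ) × ℝ → ℝ} {p : (Fin n → ℝ) × ℝ}
    (h : S =ᶠ[𝓝 p] K) (hp : p ∈ K) (hVW : EqOn V W K) : dtime S V p = dtime K W p := by
  rw [dtime, dtime, fderivWithin_congr_set h, fderivWithin_congr hVW (hVW hp)]

theorem closure_prod_eventuallyEq (hO : IsOpen O) (I : Set ℝ) {p : (Fin n → ℝ) × ℝ}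
    (hp : p.1 ∈ O) : closure O ×ˢ I =ᶠ[𝓝 p] O ×ˢ I := by
  filter_upwards [(hO.preimage continuous_fst).mem_nhds hp] with q hq
  exact propext ⟨fun h => ⟨hq, h.2⟩, fun h => ⟨subset_closure h.1, h.2⟩⟩

theorem hasDerivWithinAt_dtime {I : Set ℝ} {F : (Fin n → ℝ) × ℝ → ℝ} {θ : Fin n → ℝ} {t : ℝ}
    (hθ : θ ∈ O) (hF : DifferentiableWithinAt ℝ F (O ×ˢ I) (θ, t)) :
    HasDerivWithinAt (fun s => F (θ, s)) (dtime (O ×ˢ I) F (θ, t)) I t :=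
  hF.hasFDerivWithinAt.comp_hasDerivWithinAt t
    ((hasDerivWithinAt_const t I θ).prodMk (hasDerivWithinAt_id t I))
    fun _ hs => ⟨hθ, hs⟩

theorem contDiffOn_dtheta {W : (Fin n → ℝ) × ℝ → ℝ} (hK : UniqueDiffOn ℝ K)
    (hW : ContDiffOn ℝ 2 W K) (i : Fin n) : ContDiffOn ℝ 1 (dtheta K W i) K :=
  (hW.fderivWithin hK (by norm_num)).clm_apply contDiffOn_const

theorem norm_single_zero_le (i : Fin n) : ‖((Pi.single i 1, 0) : (Fin n → ℝ) × ℝ)‖ ≤ 1 := by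
  simp [Prod.norm_def, Pi.norm_single]

theorem norm_zero_one_le : ‖((0, 1) : (Fin n → ℝ) × ℝ)‖ ≤ 1 := by
  simp [Prod.norm_def]

theorem exists_norm_fderivWithin_le {W : (Fin n → ℝ) × ℝ → ℝ} (hS : IsCompact S) (hKS : K ⊆ S)
    (hK : UniqueDiffOn ℝ K) (hW : ContDiffOn ℝ 1 W S) :
    ∃ C, ∀ p ∈ K, ∀ v : (Fin n → ℝ) × ℝ, ‖v‖ ≤ 1 → |fderivWithin ℝ W K p v| ≤ C := by
  obtain ⟨C, hC⟩ := ContDiffOn.exists_norm_iteratedFDerivWithin_le (m := 1) (by simpa using hW)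
    hS hKS hK
  refine ⟨C, fun p hp v hv => ?_⟩
  rw [← Real.norm_eq_abs]
  refine ((fderivWithin ℝ W K p).unit_le_opNorm v hv).trans ?_
  rw [← norm_iteratedFDerivWithin_one W (hK p hp)]
  exact hC p hp

theorem exists_abs_dtime_dtheta_le {W : (Fin n → ℝ) × ℝ → ℝ} (hS : IsCompact S) (hKS : K ⊆ S)
    (hK : UniqueDiffOn ℝ K) (hW : ContDiffOn ℝ 2 W S) (i : Fin n) :
    ∃ C, ∀ p ∈ K, |dtime K (dtheta K W i) p| ≤ C := by
  obtain ⟨C, hC⟩ := ContDiffOn.exists_norm_iteratedFDerivWithin_le (m := 2) (by simpa using hW)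
    hS hKS hK
  refine ⟨C, fun p hp => ?_⟩
  have hd : DifferentiableWithinAt ℝ (fderivWithin ℝ W K) K p :=
    (((hW.mono hKS).fderivWithin hK (m := 1) (by norm_num)).differentiableOn (by norm_num)) p hp
  have h : dtime K (dtheta K W i) p
      = iteratedFDerivWithin ℝ 2 W K p ![(0, 1), (Pi.single i 1, 0)] := by
    rw [iteratedFDerivWithin_two_apply' W hK hp, dtime]
    have h' := hd.hasFDerivWithinAt.clm_apply
      (hasFDerivWithinAt_const ((Pi.single i 1, 0) : (Fin n → ℝ) × ℝ) p K)
    have h2 : fderivWithin ℝ (dtheta K W i) K p = _ := h'.fderivWithin (hK p hp)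
    rw [h2]
    simp
  rw [h, ← Real.norm_eq_abs]
  refine ((iteratedFDerivWithin ℝ 2 W K p).le_opNorm _).trans ?_
  have h1 : ∏ k, ‖(![(0, 1), (Pi.single i 1, 0)] : Fin 2 → (Fin n → ℝ) × ℝ) k‖ ≤ 1 := by
    rw [Fin.prod_univ_two]
    exact mul_le_one₀ norm_zero_one_le (norm_nonneg _) (norm_single_zero_le i)
  exact (mul_le_of_le_one_right (norm_nonneg _) h1).trans (hC p hp)

/-- The Jacobian matrix `∂_{θ_i} X_l` of a parametrized surface, with derivatives within `S`. -/
noncomputable def jacobianMat (S : Set ((Fin n → ℝ) × ℝ)) (X : (Fin n → ℝ) × ℝ → Fin (n + 1) → ℝ)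
    (p : (Fin n → ℝ) × ℝ) : Matrix (Fin n) (Fin (n + 1)) ℝ :=
  Matrix.of fun i l => dtheta S (fun q => X q l) i p

theorem metricMat_eq (S : Set ((Fin n → ℝ) × ℝ)) (X : (Fin n → ℝ) × ℝ → Fin (n + 1) → ℝ)
    (p : (Fin n → ℝ) × ℝ) : metricMat S X p = jacobianMat S X p * (jacobianMat S X p)ᵀ := by
  ext i j
  simp [metricMat, jacobianMat, Matrix.mul_apply]

theorem jacobianMat_eq_of_eventuallyEq {X : (Fin n → ℝ) × ℝ → Fin (n + 1) → ℝ}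
    {p : (Fin n → ℝ) × ℝ} (h : S =ᶠ[𝓝 p] K) : jacobianMat S X p = jacobianMat K X p := by
  ext i l
  exact dtheta_eq_of_eventuallyEq h

end Slice

/-- Transport theorem (Leibniz formula) on a moving parametrized hypersurface:
`d/dt ∫_O U √(det g) dθ
   = ∫_O ( ∂_t U + U Σ_{i,j} g^{ij} (∂_t ∂_{θ_i} X) · (∂_{θ_j} X) ) √(det g) dθ`. -/
theorem transport_theorem {n : ℕ}
    (O : Set (Fin n → ℝ)) (hO : IsOpen O) (hObdd : Bornology.IsBounded O)
    (T : ℝ) (hT : 0 < T)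
    (X : (Fin n → ℝ) × ℝ → Fin (n + 1) → ℝ) (U : (Fin n → ℝ) × ℝ → ℝ)
    (S : Set ((Fin n → ℝ) × ℝ)) (hS : S = closure O ×ˢ Set.Icc 0 T)
    (hX : ContDiffOn ℝ 2 X S) (hU : ContDiffOn ℝ 1 U S)
    (hpos : ∀ p ∈ S, (metricMat S X p).PosDef) :
    ∀ t ∈ Set.Icc 0 T,
      HasDerivWithinAt
        (fun s => ∫ θ in O, U (θ, s) * Real.sqrt (metricMat S X (θ, s)).det)
        (∫ θ in O,
          (dtime S U (θ, t)
            + U (θ, t) *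
              ∑ i, ∑ j, (metricMat S X (θ, t))⁻¹ i j *
                ∑ l, dtime S (fun q => dtheta S (fun q' => X q' l) i q) (θ, t)
                  * dtheta S (fun q => X q l) j (θ, t))
            * Real.sqrt (metricMat S X (θ, t)).det)
        (Set.Icc 0 T) t := by
  set K : Set ((Fin n → ℝ) × ℝ) := O ×ˢ Icc 0 T with hKdef
  have hSc : IsCompact S := hS ▸ hObdd.isCompact_closure.prod isCompact_Icc
  have hKS : K ⊆ S := hS ▸ prod_mono_left subset_closure
  have hK : UniqueDiffOn ℝ K := hO.uniqueDiffOn.prod (uniqueDiffOn_Icc hT)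
  have hSK : ∀ p ∈ K, S =ᶠ[𝓝 p] K := fun p hp => hS ▸ closure_prod_eventuallyEq hO _ hp.1
  have hXS : ∀ l, ContDiffOn ℝ 2 (fun q => X q l) S := contDiffOn_pi.1 hX
  set B : (Fin n → ℝ) × ℝ → Matrix (Fin n) (Fin (n + 1)) ℝ :=
    fun p => Matrix.of fun i l => dtime K (dtheta K (fun q => X q l) i) p with hB
  set A := jacobianMat K X with hA
  have hmetric : ∀ p ∈ K, metricMat S X p = A p * (A p)ᵀ := fun p hp => by
    rw [metricMat_eq, jacobianMat_eq_of_eventuallyEq (hSK p hp)]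
  have hdet : ∀ p ∈ K, 0 < (A p * (A p)ᵀ).det := fun p hp =>
    hmetric p hp ▸ (hpos p (hKS hp)).det_pos
  have hAcd : ∀ i l, ContDiffOn ℝ 1 (fun p => A p i l) K := fun i l =>
    contDiffOn_dtheta hK ((hXS l).mono hKS) i
  have hAcont : ContinuousOn A K :=
    continuousOn_pi.2 fun i => continuousOn_pi.2 fun l => (hAcd i l).continuousOn
  have hdetcont : Continuous fun M : Matrix (Fin n) (Fin (n + 1)) ℝ => √(M * Mᵀ).det := by
    fun_prop
  have hadjcont : Continuous fun M : Matrix (Fin n) (Fin (n + 1)) ℝ =>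
      (M * Mᵀ).adjugate.trace := by
    fun_prop
  have hBcont : Continuous fun M : Matrix (Fin n) (Fin (n + 1)) ℝ => ∑ i, ∑ l, M i l ^ 2 := by
    fun_prop
  obtain ⟨CU, hCU⟩ := hSc.exists_bound_of_continuousOn hU.continuousOn
  obtain ⟨CU', hCU'⟩ := exists_norm_fderivWithin_le hSc hKS hK hU
  obtain ⟨CA, hCA⟩ : ∃ C, ∀ p ∈ K, ∀ i l, |A p i l| ≤ C := by
    choose C hC using fun l => exists_norm_fderivWithin_le hSc hKS hK ((hXS l).of_le one_le_two)
    refine ⟨∑ l, |C l|, fun p hp i l => ?_⟩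
    exact ((hC l p hp _ (norm_single_zero_le i)).trans (le_abs_self _)).trans
      (Finset.single_le_sum (f := fun l => |C l|) (fun _ _ => abs_nonneg _) (Finset.mem_univ l))
  obtain ⟨CB, hCB⟩ : ∃ C, ∀ p ∈ K, ∀ i l, |B p i l| ≤ C := by
    choose C hC using fun i l => exists_abs_dtime_dtheta_le hSc hKS hK (hXS l) i
    refine ⟨∑ i, ∑ l, |C i l|, fun p hp i l => ?_⟩
    refine ((hC i l p hp).trans (le_abs_self _)).trans ?_
    exact (Finset.single_le_sum (f := fun l => |C i l|) (fun _ _ => abs_nonneg _)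
      (Finset.mem_univ l)).trans (Finset.single_le_sum (f := fun i => ∑ l, |C i l|)
        (fun _ _ => Finset.sum_nonneg fun _ _ => abs_nonneg _) (Finset.mem_univ i))
  obtain ⟨D₁, hD₁⟩ := Matrix.exists_abs_le_of_continuous hdetcont CA
  obtain ⟨D₂, hD₂⟩ := Matrix.exists_abs_le_of_continuous hadjcont CA
  obtain ⟨D₃, hD₃⟩ := Matrix.exists_abs_le_of_continuous hBcont CB
  set div : (Fin n → ℝ) × ℝ → ℝ := fun p =>
    ∑ i, ∑ j, (A p * (A p)ᵀ)⁻¹ i j * ∑ l, B p i l * A p j l with hdiv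
  intro t ht
  have hvol : volume O < ⊤ := hObdd.measure_lt_top
  have : IsFiniteMeasure (volume.restrict O) := ⟨by simpa using hvol⟩
  have hfun : ∀ s ∈ Icc 0 T, ∫ θ in O, U (θ, s) * √(metricMat S X (θ, s)).det
      = ∫ θ in O, U (θ, s) * √(A (θ, s) * (A (θ, s))ᵀ).det := fun s hs =>
    setIntegral_congr_fun hO.measurableSet fun θ hθ => by
      simp only [hmetric (θ, s) ⟨hθ, hs⟩]
  have hrhs : (∫ θ in O,
          (dtime S U (θ, t)
            + U (θ, t) *
              ∑ i, ∑ j, (metricMat S X (θ, t))⁻¹ i j *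
                ∑ l, dtime S (fun q => dtheta S (fun q' => X q' l) i q) (θ, t)
                  * dtheta S (fun q => X q l) j (θ, t))
            * √(metricMat S X (θ, t)).det)
      = ∫ θ in O, (dtime K U (θ, t) + U (θ, t) * div (θ, t))
          * √(A (θ, t) * (A (θ, t))ᵀ).det := by
    refine setIntegral_congr_fun hO.measurableSet fun θ hθ => ?_
    have hp : (θ, t) ∈ K := ⟨hθ, ht⟩
    have h1 : ∀ i l, dtime S (fun q => dtheta S (fun q' => X q' l) i q) (θ, t) = B (θ, t) i l :=
      fun i l => dtime_eq_of_eventuallyEq (hSK _ hp) hp fun q hq =>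
        dtheta_eq_of_eventuallyEq (hSK q hq)
    have h2 : ∀ j l, dtheta S (fun q => X q l) j (θ, t) = A (θ, t) j l := fun j l =>
      dtheta_eq_of_eventuallyEq (hSK _ hp)
    simp only [hmetric _ hp, h1, h2, dtime_eq_of_eventuallyEq (hSK _ hp) hp (eqOn_refl U K), hdiv]
  rw [hrhs]
  refine HasDerivWithinAt.congr_of_mem ?_ hfun ht
  refine hasDerivWithinAt_integral_of_norm_deriv_le
    (f := fun θ s => U (θ, s) * √(A (θ, s) * (A (θ, s))ᵀ).det)
    (f' := fun θ s => (dtime K U (θ, s) + U (θ, s) * div (θ, s))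
          * √(A (θ, s) * (A (θ, s))ᵀ).det)
    (bound := fun _ => CU' * D₁ + CU * √(D₃ * D₂))
    (convex_Icc 0 T) ht (integrable_const _) ?_ ?_ ?_
  · intro s hs
    have hmaps : MapsTo (fun θ : Fin n → ℝ => (θ, s)) O K := fun θ hθ => ⟨hθ, hs⟩
    have hslice : ContinuousOn (fun θ : Fin n → ℝ => (θ, s)) O := by fun_prop
    have hc : ContinuousOn (fun θ => U (θ, s) * √(A (θ, s) * (A (θ, s))ᵀ).det) O :=
      (((hU.mono hKS).continuousOn).comp hslice hmaps).mul
        (hdetcont.comp_continuousOn (hAcont.comp hslice hmaps))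
    refine Integrable.of_bound (hc.aestronglyMeasurable hO.measurableSet) (CU * D₁) ?_
    filter_upwards [ae_restrict_mem hO.measurableSet] with θ hθ
    rw [norm_mul]
    have hp := hmaps hθ
    exact mul_le_mul (hCU _ (hKS hp)) (hD₁ _ (hCA _ hp)) (norm_nonneg _)
      ((norm_nonneg _).trans (hCU _ (hKS hp)))
  · filter_upwards [ae_restrict_mem hO.measurableSet] with θ hθ s hs
    have hp : (θ, s) ∈ K := ⟨hθ, hs⟩
    have h1 : HasDerivWithinAt (fun r => U (θ, r)) (dtime K U (θ, s)) (Icc 0 T) s :=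
      hasDerivWithinAt_dtime hθ ((hU.mono hKS).differentiableOn one_ne_zero _ hp)
    have h2 : HasDerivWithinAt (fun r => √(A (θ, r) * (A (θ, r))ᵀ).det)
        (div (θ, s) * √(A (θ, s) * (A (θ, s))ᵀ).det) (Icc 0 T) s :=
      Matrix.hasDerivWithinAt_sqrt_det_mul_transpose (A := fun r => A (θ, r)) (A' := B (θ, s))
        (fun i l => hasDerivWithinAt_dtime hθ ((hAcd i l).differentiableOn one_ne_zero _ hp))
        (hdet _ hp)
    exact (h1.mul h2).congr_deriv (by ring)
  · filter_upwards [ae_restrict_mem hO.measurableSet] with θ hθ s hs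
    have hp : (θ, s) ∈ K := ⟨hθ, hs⟩
    have h1 := Matrix.abs_sum_inv_mul_sqrt_det_le (A (θ, s)) (B (θ, s)) (hdet _ hp)
    have h2 : √((∑ i, ∑ l, B (θ, s) i l ^ 2) * (A (θ, s) * (A (θ, s))ᵀ).adjugate.trace)
        ≤ √(D₃ * D₂) := by
      refine Real.sqrt_le_sqrt ((le_abs_self _).trans ?_)
      rw [abs_mul]
      exact mul_le_mul (hD₃ _ (hCB _ hp)) (hD₂ _ (hCA _ hp)) (abs_nonneg _)
        ((abs_nonneg _).trans (hD₃ _ (hCB _ hp)))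
    have h3 : |dtime K U (θ, s)| ≤ CU' := hCU' _ hp _ norm_zero_one_le
    rw [add_mul, mul_assoc (U (θ, s))]
    refine (norm_add_le _ _).trans (add_le_add ?_ ?_)
    · rw [norm_mul]
      exact mul_le_mul h3 (hD₁ _ (hCA _ hp)) (norm_nonneg _) ((abs_nonneg _).trans h3)
    · rw [norm_mul]
      exact mul_le_mul (hCU _ (hKS hp)) (h1.trans h2) (norm_nonneg _)
        ((norm_nonneg _).trans (hCU _ (hKS hp)))
end

section
/- Let n ≥ 1, r > 0, T > 0, Ω := B_r(0) ⊂ ℝ^n, Ω_T := Ω × (0,T). Let u, ū : Ω_T → ℝ be measurable and bounded with M := max(‖u‖_{L^∞}, ‖ū‖_{L^∞}), let q : Ω̄ × [0,T] → ℝ be bounded measurable, let G : Ω̄ × [0,T] → ℝ be Lipschitz continuous with G > 0, and let f = (f_1,…,f_n) : Ω̄ × [0,T] × ℝ → ℝ^n be C¹, and set L := max over (x,t) ∈ Ω̄ × [0,T] and |w| ≤ M of ( Σ_{i=1}^n (∂_w f_i(x,t,w))² )^{1/2}; let L' ≥ 0 satisfy |Σ_i ∂_{x_i} f_i(x,t,a)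 − Σ_i ∂_{x_i} f_i(x,t,b)| ≤ L'|a − b| for all (x,t) ∈ Ω̄ × [0,T] and a,b ∈ [−M,M]. Assume that for every nonnegative Lipschitz function φ with compact support in Ω_T, ∫_{Ω_T} [ |u − ū| ∂_t φ + sign(u − ū) Σ_i (f_i(x,t,u) − f_i(x,t,ū)) ∂_{x_i} φ − sign(u − ū) Σ_i (∂_{x_i} f_i(x,t,u) − ∂_{x_i} f_i(x,t,ū)) φ + |u − ū| q φ ] G² ≥ 0 (with u = u(x,t), ū = ū(x,t)). Define S_t := { x ∈ ℝ^n : ‖x‖ ≤ r − L t } and μ(t) := ∫_{S_t} |u(x,t) − ū(x,t)| G(x,t)² dx. Then for all τ₁ < τ₂ in (0,T) with r − L τ₂ > 0 that are Lebesgue points of μ: μ(τ₂) ≤ μ(τ₁) · exp( (‖q‖_{L^∞} + L')(τ₂ − τ₁) ). -/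
open MeasureTheory
open scoped BigOperators

/-- `τ` is a Lebesgue point of `g : ℝ → ℝ`. -/
def IsLebesguePoint (g : ℝ → ℝ) (τ : ℝ) : Prop :=
  Filter.Tendsto (fun δ : ℝ => (2 * δ)⁻¹ * ∫ s in Set.Ioo (τ - δ) (τ + δ), |g s - g τ|)
    (nhdsWithin 0 (Set.Ioi 0)) (nhds 0)

section Auxiliary

open Filter Set Topology

theorem Continuous.isLebesguePoint {a : ℝ → ℝ} (ha : Continuous a) (τ : ℝ) :
    IsLebesguePoint a τ := by
  unfold IsLebesguePoint
  rw [Metric.tendsto_nhds]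
  intro ε hε
  obtain ⟨d, hd, hda⟩ := Metric.continuous_iff.1 ha τ (ε / 2) (half_pos hε)
  filter_upwards [Ioo_mem_nhdsGT hd] with δ hδ
  have hδ0 : 0 < δ := hδ.1
  have hint : ‖∫ s in Ioo (τ - δ) (τ + δ), |a s - a τ|‖
      ≤ ε / 2 * volume.real (Ioo (τ - δ) (τ + δ)) := by
    refine norm_setIntegral_le_of_norm_le_const (by simp) fun s hs => ?_
    rw [Real.norm_eq_abs, abs_abs, ← Real.dist_eq]
    refine (hda s ?_).le
    rw [Real.dist_eq, abs_lt]
    constructor <;> linarith [hs.1, hs.2, hδ.2]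
  rw [Real.volume_real_Ioo_of_le (by linarith), Real.norm_eq_abs] at hint
  rw [Real.dist_eq, sub_zero, abs_mul, abs_of_pos (by positivity : (0 : ℝ) < (2 * δ)⁻¹),
    inv_mul_lt_iff₀ (by positivity)]
  nlinarith

theorem eventually_Ioo_subset {a b τ : ℝ} (hτ : τ ∈ Ioo a b) :
    ∀ᶠ δ in 𝓝[>] (0 : ℝ), Ioo (τ - δ) (τ + δ) ⊆ Ioo a b := by
  filter_upwards [Ioo_mem_nhdsGT (lt_min (sub_pos.2 hτ.1) (sub_pos.2 hτ.2))] with δ hδ s hs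
  have h := lt_min_iff.1 hδ.2
  exact ⟨by linarith [hs.1, h.1], by linarith [hs.2, h.2]⟩

theorem IsLebesguePoint.continuous_mul {a m : ℝ → ℝ} (ha : Continuous a) {τ b c : ℝ}
    (hτ : τ ∈ Ioo b c) (hm : IntegrableOn m (Ioo b c)) (hL : IsLebesguePoint m τ) :
    IsLebesguePoint (fun t => a t * m t) τ := by
  obtain ⟨A, hA⟩ := (isCompact_Icc (a := b) (b := c)).exists_bound_of_continuousOn ha.continuousOn
  have hlim := (hL.const_mul A).add ((ha.isLebesguePoint τ).mul_const |m τ|)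
  rw [mul_zero, zero_mul, add_zero] at hlim
  refine squeeze_zero' ?_ ?_ hlim
  · filter_upwards [self_mem_nhdsWithin] with δ hδ
    have hδ0 : (0 : ℝ) < δ := hδ
    exact mul_nonneg (by positivity) (integral_nonneg fun _ => abs_nonneg _)
  · filter_upwards [self_mem_nhdsWithin, eventually_Ioo_subset hτ] with δ hδ hsub
    have hδ0 : (0 : ℝ) < δ := hδ
    have hfin : volume (Ioo (τ - δ) (τ + δ)) ≠ ⊤ := by simp
    have hm' : IntegrableOn m (Ioo (τ - δ) (τ + δ)) := hm.mono_set hsub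
    have ha' : IntegrableOn a (Ioo (τ - δ) (τ + δ)) :=
      (ha.integrableOn_Icc (a := τ - δ) (b := τ + δ)).mono_set Ioo_subset_Icc_self
    have h1 : IntegrableOn (fun s => |m s - m τ|) (Ioo (τ - δ) (τ + δ)) :=
      (hm'.sub (integrableOn_const hfin)).abs
    have h2 : IntegrableOn (fun s => |a s - a τ|) (Ioo (τ - δ) (τ + δ)) :=
      (ha'.sub (integrableOn_const hfin)).abs
    have hle : ∫ s in Ioo (τ - δ) (τ + δ), |a s * m s - a τ * m τ|
        ≤ ∫ s in Ioo (τ - δ) (τ + δ), (A * |m s - m τ| + |a s - a τ| * |m τ|) := by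
      refine integral_mono_of_nonneg (ae_of_all _ fun _ => abs_nonneg _)
        ((h1.const_mul A).add (h2.mul_const _)) ?_
      refine (ae_restrict_iff' measurableSet_Ioo).2 (ae_of_all _ fun s hs => ?_)
      have hAs : |a s| ≤ A := hA s (Ioo_subset_Icc_self (hsub hs))
      calc |a s * m s - a τ * m τ| = |a s * (m s - m τ) + (a s - a τ) * m τ| := by ring_nf
        _ ≤ |a s| * |m s - m τ| + |a s - a τ| * |m τ| := by
            rw [← abs_mul, ← abs_mul]; exact abs_add_le _ _
        _ ≤ A * |m s - m τ| + |a s - a τ| * |m τ| := by gcongr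
    rw [integral_add (h1.const_mul A) (h2.mul_const _), integral_const_mul,
      integral_mul_const] at hle
    calc _ ≤ (2 * δ)⁻¹ * _ := mul_le_mul_of_nonneg_left hle (by positivity)
      _ = _ := by ring

/-- A smooth step of width `δ` at `τ`. -/
noncomputable def smoothStep (τ δ t : ℝ) : ℝ :=
  Real.smoothTransition ((t - τ) / δ + 1 / 2)

theorem contDiff_smoothStep (τ δ : ℝ) : ContDiff ℝ 1 (smoothStep τ δ) := by
  unfold smoothStep
  exact Real.smoothTransition.contDiff.comp
    (((contDiff_id.sub contDiff_const).div_const δ).add contDiff_const)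

theorem smoothStep_eq_zero {τ δ t : ℝ} (hδ : 0 < δ) (ht : t ≤ τ - δ / 2) :
    smoothStep τ δ t = 0 := by
  refine Real.smoothTransition.zero_of_nonpos ?_
  have : (t - τ) / δ ≤ -(1 / 2) := by rw [div_le_iff₀ hδ]; linarith
  linarith

theorem smoothStep_eq_one {τ δ t : ℝ} (hδ : 0 < δ) (ht : τ + δ / 2 ≤ t) :
    smoothStep τ δ t = 1 := by
  refine Real.smoothTransition.one_of_one_le ?_
  have : 1 / 2 ≤ (t - τ) / δ := by rw [le_div_iff₀ hδ]; linarith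
  linarith

theorem smoothStep_anti {τ₁ τ₂ δ : ℝ} (hδ : 0 < δ) (h : τ₁ ≤ τ₂) (t : ℝ) :
    smoothStep τ₂ δ t ≤ smoothStep τ₁ δ t :=
  Real.smoothTransition.monotone (by gcongr)

theorem hasDerivAt_smoothStep (τ δ t : ℝ) :
    HasDerivAt (smoothStep τ δ) (deriv Real.smoothTransition ((t - τ) / δ + 1 / 2) / δ) t := by
  have h1 : HasDerivAt (fun t : ℝ => (t - τ) / δ + 1 / 2) (1 / δ) t :=
    (((hasDerivAt_id t).sub_const τ).div_const δ).add_const _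
  have h2 := ((Real.smoothTransition.contDiff (n := 1)).differentiable one_ne_zero
    ((t - τ) / δ + 1 / 2)).hasDerivAt
  rw [← mul_one_div]
  exact h2.comp t h1

theorem deriv_smoothTransition_of_notMem {s : ℝ} (hs : s ∉ Icc (0 : ℝ) 1) :
    deriv Real.smoothTransition s = 0 := by
  rcases lt_or_ge s 0 with h | h
  · have : Real.smoothTransition =ᶠ[𝓝 s] fun _ => 0 := by
      filter_upwards [Iio_mem_nhds h] with t ht
      exact Real.smoothTransition.zero_of_nonpos (le_of_lt ht)
    rw [this.deriv_eq, deriv_const]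
  · have h1 : 1 < s := by
      by_contra hc
      exact hs ⟨h, not_lt.1 hc⟩
    have : Real.smoothTransition =ᶠ[𝓝 s] fun _ => 1 := by
      filter_upwards [Ioi_mem_nhds h1] with t ht
      exact Real.smoothTransition.one_of_one_le (le_of_lt ht)
    rw [this.deriv_eq, deriv_const]

theorem exists_bound_deriv_smoothTransition :
    ∃ K : ℝ, ∀ s, |deriv Real.smoothTransition s| ≤ K := by
  obtain ⟨K, hK⟩ := (isCompact_Icc (a := (0 : ℝ)) (b := 1)).exists_bound_of_continuousOn
    ((Real.smoothTransition.contDiff (n := 1)).continuous_deriv le_rfl).continuousOn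
  refine ⟨K, fun s => ?_⟩
  by_cases hs : s ∈ Icc (0 : ℝ) 1
  · exact hK s hs
  · rw [deriv_smoothTransition_of_notMem hs, abs_zero]
    exact (norm_nonneg _).trans (hK 0 ⟨le_rfl, zero_le_one⟩)

theorem support_deriv_smoothStep_subset {τ δ : ℝ} (hδ : 0 < δ) :
    Function.support (deriv (smoothStep τ δ)) ⊆ Ioo (τ - δ) (τ + δ) := by
  intro t ht
  rw [Function.mem_support, (hasDerivAt_smoothStep τ δ t).deriv] at ht
  have hmem : (t - τ) / δ + 1 / 2 ∈ Icc (0 : ℝ) 1 := by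
    by_contra hc
    exact ht (by rw [deriv_smoothTransition_of_notMem hc, zero_div])
  have h1 : -(1 / 2) ≤ (t - τ) / δ := by linarith [hmem.1]
  have h2 : (t - τ) / δ ≤ 1 / 2 := by linarith [hmem.2]
  rw [le_div_iff₀ hδ] at h1
  rw [div_le_iff₀ hδ] at h2
  constructor <;> linarith

theorem integral_deriv_smoothStep {τ δ : ℝ} (hδ : 0 < δ) :
    ∫ t, deriv (smoothStep τ δ) t = 1 := by
  have hcont : Continuous (deriv (smoothStep τ δ)) :=
    (contDiff_smoothStep τ δ).continuous_deriv le_rfl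
  rw [← setIntegral_eq_integral_of_forall_compl_eq_zero (s := Ioc (τ - δ) (τ + δ)),
    ← intervalIntegral.integral_of_le (by linarith),
    intervalIntegral.integral_deriv_eq_sub
      (fun t _ => ((contDiff_smoothStep τ δ).differentiable one_ne_zero) t)
      (hcont.intervalIntegrable _ _),
    smoothStep_eq_one hδ (by linarith), smoothStep_eq_zero hδ (by linarith), sub_zero]
  intro t ht
  by_contra hc
  exact ht (Ioo_subset_Ioc_self (support_deriv_smoothStep_subset hδ hc))

theorem tendsto_integral_deriv_smoothStep_mul {m : ℝ → ℝ} {τ b c : ℝ}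
    (hτ : τ ∈ Ioo b c) (hm : IntegrableOn m (Ioo b c)) (hL : IsLebesguePoint m τ) :
    Tendsto (fun δ : ℝ => ∫ t, deriv (smoothStep τ δ) t * m t) (𝓝[>] 0) (𝓝 (m τ)) := by
  obtain ⟨K, hK⟩ := exists_bound_deriv_smoothTransition
  refine tendsto_integral_smul_of_tendsto_average_norm_sub
    (a := fun δ : ℝ => Ioo (τ - δ) (τ + δ)) (2 * K) ?_ ?_ ?_ ?_ ?_
  · refine hL.congr' ?_
    filter_upwards [self_mem_nhdsWithin] with δ hδ
    have hδ0 : (0 : ℝ) < δ := hδ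
    rw [setAverage_eq, Real.volume_real_Ioo_of_le (by linarith), smul_eq_mul]
    congr 2
    ring
  · filter_upwards [eventually_Ioo_subset hτ] with δ hδ using hm.mono_set hδ
  · refine tendsto_const_nhds.congr' ?_
    filter_upwards [self_mem_nhdsWithin] with δ hδ using (integral_deriv_smoothStep hδ).symm
  · filter_upwards [self_mem_nhdsWithin] with δ hδ using support_deriv_smoothStep_subset hδ
  · filter_upwards [self_mem_nhdsWithin] with δ hδ t
    have hδ0 : (0 : ℝ) < δ := hδ
    rw [Real.volume_real_Ioo_of_le (by linarith), (hasDerivAt_smoothStep τ δ t).deriv, abs_div,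
      abs_of_pos hδ0, show 2 * K / (τ + δ - (τ - δ)) = K / δ by
        rw [show τ + δ - (τ - δ) = 2 * δ by ring, mul_div_mul_left _ _ two_ne_zero]]
    gcongr
    exact hK _

/-- Weak form of the Gronwall inequality between two Lebesgue points. -/
theorem le_mul_exp_of_forall_integral_nonneg {m : ℝ → ℝ} {b c C τ₁ τ₂ : ℝ}
    (hm : IntegrableOn m (Ioo b c)) (h₁ : τ₁ ∈ Ioo b c) (h₂ : τ₂ ∈ Ioo b c) (h₁₂ : τ₁ ≤ τ₂)
    (hL₁ : IsLebesguePoint m τ₁) (hL₂ : IsLebesguePoint m τ₂)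
    (hweak : ∀ θ : ℝ → ℝ, ContDiff ℝ 1 θ → (∀ t, 0 ≤ θ t) → HasCompactSupport θ →
      tsupport θ ⊆ Ioo b c → 0 ≤ ∫ t in Ioo b c, (deriv θ t + C * θ t) * m t) :
    m τ₂ ≤ m τ₁ * Real.exp (C * (τ₂ - τ₁)) := by
  have hexp : Continuous fun t : ℝ => Real.exp (-(C * t)) := by fun_prop
  have hν : IntegrableOn (fun t => Real.exp (-(C * t)) * m t) (Ioo b c) := by
    obtain ⟨A, hA⟩ := (isCompact_Icc (a := b) (b := c)).exists_bound_of_continuousOn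
      hexp.continuousOn
    exact hm.bdd_mul hexp.aestronglyMeasurable ((ae_restrict_iff' measurableSet_Ioo).2
      (ae_of_all _ fun t ht => hA t (Ioo_subset_Icc_self ht)))
  have hlim₁ := tendsto_integral_deriv_smoothStep_mul h₁ hν (hL₁.continuous_mul hexp h₁ hm)
  have hlim₂ := tendsto_integral_deriv_smoothStep_mul h₂ hν (hL₂.continuous_mul hexp h₂ hm)
  have hle : Real.exp (-(C * τ₂)) * m τ₂ ≤ Real.exp (-(C * τ₁)) * m τ₁ := by
    refine le_of_tendsto_of_tendsto hlim₂ hlim₁ ?_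
    filter_upwards [self_mem_nhdsWithin, eventually_Ioo_subset h₁, eventually_Ioo_subset h₂,
      Ioo_mem_nhdsGT (lt_min (sub_pos.2 h₁.1) (sub_pos.2 h₂.2))] with δ hδ hs₁ hs₂ hδ'
    have hδ0 : (0 : ℝ) < δ := hδ
    have hδm := lt_min_iff.1 hδ'.2
    have hd₁ : ∀ t, HasDerivAt (smoothStep τ₁ δ) (deriv (smoothStep τ₁ δ) t) t := fun t =>
      ((contDiff_smoothStep τ₁ δ).differentiable one_ne_zero t).hasDerivAt
    have hd₂ : ∀ t, HasDerivAt (smoothStep τ₂ δ) (deriv (smoothStep τ₂ δ) t) t := fun t =>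
      ((contDiff_smoothStep τ₂ δ).differentiable one_ne_zero t).hasDerivAt
    set θ : ℝ → ℝ := fun t => Real.exp (-(C * t)) * (smoothStep τ₁ δ t - smoothStep τ₂ δ t)
      with hθ
    have hsupp : Function.support θ ⊆ Icc (τ₁ - δ) (τ₂ + δ) := by
      intro t ht
      by_contra hc
      refine ht ?_
      rcases lt_or_ge t (τ₁ - δ) with h | h
      · simp [hθ, smoothStep_eq_zero hδ0 (show t ≤ τ₁ - δ / 2 by linarith),
          smoothStep_eq_zero hδ0 (show t ≤ τ₂ - δ / 2 by linarith)]
      · have h' : τ₂ + δ < t := by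
          by_contra hc'
          exact hc ⟨h, not_lt.1 hc'⟩
        simp [hθ, smoothStep_eq_one hδ0 (show τ₁ + δ / 2 ≤ t by linarith),
          smoothStep_eq_one hδ0 (show τ₂ + δ / 2 ≤ t by linarith)]
    have hts : tsupport θ ⊆ Icc (τ₁ - δ) (τ₂ + δ) := closure_minimal hsupp isClosed_Icc
    have hderiv : ∀ t, deriv θ t + C * θ t
        = Real.exp (-(C * t)) * (deriv (smoothStep τ₁ δ) t - deriv (smoothStep τ₂ δ) t) := by
      intro t
      have he : HasDerivAt (fun t : ℝ => Real.exp (-(C * t))) (Real.exp (-(C * t)) * -(C * 1)) t :=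
        (((hasDerivAt_id t).const_mul C).neg).exp
      rw [show deriv θ t = _ from (he.mul ((hd₁ t).sub (hd₂ t))).deriv]
      simp only [hθ, Pi.sub_apply]
      ring
    have key := hweak θ
      ((Real.contDiff_exp.comp (contDiff_const.mul contDiff_id).neg).mul
        ((contDiff_smoothStep τ₁ δ).sub (contDiff_smoothStep τ₂ δ)))
      (fun t => mul_nonneg (Real.exp_pos _).le (sub_nonneg.2 (smoothStep_anti hδ0 h₁₂ t)))
      (HasCompactSupport.of_support_subset_isCompact isCompact_Icc hsupp)
      (fun t ht => ⟨by linarith [(hts ht).1], by linarith [(hts ht).2]⟩)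
    have hint : ∀ τ : ℝ, IntegrableOn
        (fun t => deriv (smoothStep τ δ) t * (Real.exp (-(C * t)) * m t)) (Ioo b c) := by
      intro τ
      have hcont : Continuous (deriv (smoothStep τ δ)) :=
        (contDiff_smoothStep τ δ).continuous_deriv le_rfl
      obtain ⟨A, hA⟩ := (isCompact_Icc (a := b) (b := c)).exists_bound_of_continuousOn
        hcont.continuousOn
      exact hν.bdd_mul hcont.aestronglyMeasurable ((ae_restrict_iff' measurableSet_Ioo).2
        (ae_of_all _ fun t ht => hA t (Ioo_subset_Icc_self ht)))
    have hset : ∀ τ : ℝ, Ioo (τ - δ) (τ + δ) ⊆ Ioo b c →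
        ∫ t in Ioo b c, deriv (smoothStep τ δ) t * (Real.exp (-(C * t)) * m t)
          = ∫ t, deriv (smoothStep τ δ) t * (Real.exp (-(C * t)) * m t) := by
      intro τ hs
      refine setIntegral_eq_integral_of_forall_compl_eq_zero fun t ht => ?_
      by_contra hc
      exact ht (hs (support_deriv_smoothStep_subset hδ0 (left_ne_zero_of_mul hc)))
    have hsplit : ∫ t in Ioo b c, (deriv θ t + C * θ t) * m t
        = (∫ t, deriv (smoothStep τ₁ δ) t * (Real.exp (-(C * t)) * m t))
          - ∫ t, deriv (smoothStep τ₂ δ) t * (Real.exp (-(C * t)) * m t) := by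
      rw [← hset τ₁ hs₁, ← hset τ₂ hs₂, ← integral_sub (hint τ₁) (hint τ₂)]
      refine integral_congr_ae (ae_of_all _ fun t => ?_)
      simp only [hderiv]
      ring
    rw [hsplit] at key
    exact sub_nonneg.1 key
  have h := mul_le_mul_of_nonneg_left hle (Real.exp_pos (C * τ₂)).le
  rw [← mul_assoc, ← mul_assoc, ← Real.exp_add, ← Real.exp_add, add_neg_cancel, Real.exp_zero,
    one_mul] at h
  rw [mul_comm, show C * (τ₂ - τ₁) = C * τ₂ + -(C * τ₁) by ring]
  rwa [mul_comm] at h ⊢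

theorem abs_sum_flux_sub_mul_le {n : ℕ} {g : ℝ → Fin n → ℝ} {M L : ℝ} (hL : 0 ≤ L)
    (hg : ∀ i, Differentiable ℝ fun w => g w i)
    (hspeed : ∀ w, |w| ≤ M → ∑ i, (deriv (fun w' => g w' i) w) ^ 2 ≤ L ^ 2)
    {a b : ℝ} (ha : |a| ≤ M) (hb : |b| ≤ M) (ξ : EuclideanSpace ℝ (Fin n)) :
    |∑ i, (g a i - g b i) * ξ i| ≤ L * ‖ξ‖ * |a - b| := by
  have hderiv : ∀ w, HasDerivAt (fun w => ∑ i, g w i * ξ i)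
      (∑ i, deriv (fun w' => g w' i) w * ξ i) w := fun w =>
    HasDerivAt.fun_sum fun i _ => ((hg i w).hasDerivAt.mul_const (ξ i))
  have hbound : ∀ w ∈ Icc (-M) M, ‖deriv (fun w => ∑ i, g w i * ξ i) w‖ ≤ L * ‖ξ‖ := by
    intro w hw
    rw [(hderiv w).deriv, Real.norm_eq_abs]
    refine abs_le_of_sq_le_sq ?_ (by positivity)
    calc (∑ i, deriv (fun w' => g w' i) w * ξ i) ^ 2
        ≤ (∑ i, (deriv (fun w' => g w' i) w) ^ 2) * ∑ i, ξ i ^ 2 :=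
          Finset.sum_mul_sq_le_sq_mul_sq _ _ _
      _ ≤ L ^ 2 * ‖ξ‖ ^ 2 := by
          rw [EuclideanSpace.real_norm_sq_eq]
          gcongr
          exact hspeed w (abs_le.2 hw)
      _ = (L * ‖ξ‖) ^ 2 := by ring
  have h := (convex_Icc (-M) M).norm_image_sub_le_of_norm_deriv_le
    (fun w _ => (hderiv w).differentiableAt) hbound (abs_le.1 hb) (abs_le.1 ha)
  simpa only [← Finset.sum_sub_distrib, ← sub_mul, Real.norm_eq_abs] using h

theorem ContinuousOn.aestronglyMeasurable_comp {X Y : Type*} [MeasurableSpace X]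
    [TopologicalSpace Y] [MeasurableSpace Y] [OpensMeasurableSpace Y] {H : Y → ℝ} {S : Set Y}
    (hH : ContinuousOn H S) (hS : MeasurableSet S) {g : X → Y} (hg : Measurable g) {A : Set X}
    (hA : MeasurableSet A) (hmaps : MapsTo g A S) (ν : Measure X) :
    AEStronglyMeasurable (fun x => H (g x)) (ν.restrict A) := by
  classical
  have hpw : Measurable (S.piecewise H fun _ => 0) :=
    hH.measurable_piecewise continuousOn_const hS
  refine (hpw.comp hg).aestronglyMeasurable.congr ?_
  filter_upwards [ae_restrict_mem hA] with x hx
  exact piecewise_eq_of_mem _ _ _ (hmaps hx)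

section Flux

variable {n : ℕ} {f : EuclideanSpace ℝ (Fin n) → ℝ → ℝ → Fin n → ℝ}
  {K : Set (EuclideanSpace ℝ (Fin n))} {J : Set ℝ}

theorem contDiffOn_flux_apply
    (hf : ContDiffOn ℝ 1 (fun q : (EuclideanSpace ℝ (Fin n) × ℝ) × ℝ => f q.1.1 q.1.2 q.2)
      ((K ×ˢ J) ×ˢ (univ : Set ℝ))) (i : Fin n) :
    ContDiffOn ℝ 1 (fun q : (EuclideanSpace ℝ (Fin n) × ℝ) × ℝ => f q.1.1 q.1.2 q.2 i)
      ((K ×ˢ J) ×ˢ (univ : Set ℝ)) :=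
  contDiffOn_pi.1 hf i

theorem differentiable_flux_apply
    (hf : ContDiffOn ℝ 1 (fun q : (EuclideanSpace ℝ (Fin n) × ℝ) × ℝ => f q.1.1 q.1.2 q.2)
      ((K ×ˢ J) ×ˢ (univ : Set ℝ))) {p : EuclideanSpace ℝ (Fin n) × ℝ} (hp : p ∈ K ×ˢ J)
    (i : Fin n) : Differentiable ℝ fun w => f p.1 p.2 w i := by
  have h : ContDiffOn ℝ 1 (fun w : ℝ => f p.1 p.2 w i) univ :=
    (contDiffOn_flux_apply hf i).comp (contDiff_const.prodMk contDiff_id).contDiffOn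
      (fun w _ => (⟨hp, mem_univ w⟩ : (p, w) ∈ (K ×ˢ J) ×ˢ (univ : Set ℝ)))
  exact (contDiffOn_univ.1 h).differentiable one_ne_zero

theorem continuousOn_fderivWithin_flux
    (hf : ContDiffOn ℝ 1 (fun q : (EuclideanSpace ℝ (Fin n) × ℝ) × ℝ => f q.1.1 q.1.2 q.2)
      ((K ×ˢ J) ×ˢ (univ : Set ℝ)))
    {U : Set (EuclideanSpace ℝ (Fin n))} {V : Set ℝ} (hU : IsOpen U) (hV : IsOpen V)
    (hUK : U ⊆ K) (hVJ : V ⊆ J) (i : Fin n) (e : EuclideanSpace ℝ (Fin n)) :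
    ContinuousOn (fun q : (EuclideanSpace ℝ (Fin n) × ℝ) × ℝ =>
      fderivWithin ℝ (fun y => f y q.1.2 q.2 i) K q.1.1 e) ((U ×ˢ V) ×ˢ (univ : Set ℝ)) := by
  have hO : IsOpen ((U ×ˢ V) ×ˢ (univ : Set ℝ)) := (hU.prod hV).prod isOpen_univ
  have hF := (contDiffOn_flux_apply hf i).mono
    (prod_mono (prod_mono hUK hVJ) (Subset.refl (univ : Set ℝ)))
  refine ((hF.continuousOn_fderiv_of_isOpen hO le_rfl).clm_apply
    (continuousOn_const (c := ((e, (0 : ℝ)), (0 : ℝ))))).congr fun q hq => ?_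
  have h1 : HasFDerivAt (fun q : (EuclideanSpace ℝ (Fin n) × ℝ) × ℝ => f q.1.1 q.1.2 q.2 i)
      (fderiv ℝ (fun q : (EuclideanSpace ℝ (Fin n) × ℝ) × ℝ => f q.1.1 q.1.2 q.2 i) q)
      ((q.1.1, q.1.2), q.2) :=
    ((hF.differentiableOn one_ne_zero).differentiableAt (hO.mem_nhds hq)).hasFDerivAt
  have h2 : HasFDerivAt (fun y : EuclideanSpace ℝ (Fin n) => ((y, q.1.2), q.2))
      (((ContinuousLinearMap.id ℝ _).prod 0).prod 0) q.1.1 :=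
    ((hasFDerivAt_id q.1.1).prodMk (hasFDerivAt_const q.1.2 q.1.1)).prodMk
      (hasFDerivAt_const q.2 q.1.1)
  have h3 : HasFDerivAt (fun y => f y q.1.2 q.2 i) _ q.1.1 :=
    HasFDerivAt.comp (g := fun q : (EuclideanSpace ℝ (Fin n) × ℝ) × ℝ => f q.1.1 q.1.2 q.2 i)
      q.1.1 h1 h2
  rw [fderivWithin_of_mem_nhds (mem_of_superset (hU.mem_nhds hq.1.1) hUK), h3.fderiv]
  simp

end Flux

/-- A smooth approximation of the indicator function of the open cone `‖x‖ + L t < r`. -/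
noncomputable def coneCutoff {n : ℕ} (r L ε : ℝ) (p : EuclideanSpace ℝ (Fin n) × ℝ) : ℝ :=
  Real.smoothTransition ((r - (√(‖p.1‖ ^ 2 + ε ^ 2) + L * p.2)) / ε - 1)

section Cone

variable {n : ℕ} {r L ε : ℝ}

theorem coneCutoff_nonneg (p : EuclideanSpace ℝ (Fin n) × ℝ) : 0 ≤ coneCutoff r L ε p :=
  Real.smoothTransition.nonneg _

theorem coneCutoff_le_one (p : EuclideanSpace ℝ (Fin n) × ℝ) : coneCutoff r L ε p ≤ 1 :=
  Real.smoothTransition.le_one _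

theorem contDiff_coneCutoff (hε : 0 < ε) :
    ContDiff ℝ 1 (coneCutoff r L ε : EuclideanSpace ℝ (Fin n) × ℝ → ℝ) := by
  have h : ContDiff ℝ 1 fun p : EuclideanSpace ℝ (Fin n) × ℝ => √(‖p.1‖ ^ 2 + ε ^ 2) :=
    ((contDiff_fst.norm_sq ℝ).add contDiff_const).sqrt fun p => by positivity
  exact Real.smoothTransition.contDiff.comp
    (((contDiff_const.sub (h.add (contDiff_const.mul contDiff_snd))).div_const ε).sub
      contDiff_const)

theorem norm_le_sqrt_norm_sq_add_sq {E : Type*} [SeminormedAddCommGroup E] (x : E) (ε : ℝ) :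
    ‖x‖ ≤ √(‖x‖ ^ 2 + ε ^ 2) :=
  Real.le_sqrt_of_sq_le (by linarith [sq_nonneg ε])

theorem norm_add_lt_of_coneCutoff_ne_zero (hε : 0 < ε) {p : EuclideanSpace ℝ (Fin n) × ℝ}
    (hp : coneCutoff r L ε p ≠ 0) : ‖p.1‖ + L * p.2 < r - ε := by
  by_contra hc
  refine hp (Real.smoothTransition.zero_of_nonpos ?_)
  have : (r - (√(‖p.1‖ ^ 2 + ε ^ 2) + L * p.2)) / ε ≤ 1 := by
    rw [div_le_one hε]
    linarith [norm_le_sqrt_norm_sq_add_sq p.1 ε, not_lt.1 hc]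
  linarith

theorem tendsto_coneCutoff (p : EuclideanSpace ℝ (Fin n) × ℝ) :
    Tendsto (fun ε => coneCutoff r L ε p) (𝓝[>] 0)
      (𝓝 (if ‖p.1‖ + L * p.2 < r then 1 else 0)) := by
  split_ifs with h
  · refine tendsto_const_nhds.congr' ?_
    have hlim : Tendsto (fun ε : ℝ => √(‖p.1‖ ^ 2 + ε ^ 2) + L * p.2 + 2 * ε) (𝓝[>] 0)
        (𝓝 (√(‖p.1‖ ^ 2 + 0 ^ 2) + L * p.2 + 2 * 0)) :=
      ((by fun_prop : Continuous fun ε : ℝ =>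
        √(‖p.1‖ ^ 2 + ε ^ 2) + L * p.2 + 2 * ε).tendsto 0).mono_left nhdsWithin_le_nhds
    have hlt : √(‖p.1‖ ^ 2 + 0 ^ 2) + L * p.2 + 2 * 0 < r := by
      simpa [Real.sqrt_sq (norm_nonneg p.1)] using h
    filter_upwards [hlim.eventually_lt_const hlt, self_mem_nhdsWithin] with ε hε hε0
    have hε0' : (0 : ℝ) < ε := hε0
    refine (Real.smoothTransition.one_of_one_le ?_).symm
    have : 2 ≤ (r - (√(‖p.1‖ ^ 2 + ε ^ 2) + L * p.2)) / ε := by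
      rw [le_div_iff₀ hε0']
      linarith
    linarith
  · refine tendsto_const_nhds.congr' ?_
    filter_upwards [self_mem_nhdsWithin] with ε hε
    have hε0 : (0 : ℝ) < ε := hε
    by_contra hc
    exact h ((norm_add_lt_of_coneCutoff_ne_zero hε0 (Ne.symm hc)).trans (by linarith))

/-- The gradient of a cone cut-off is controlled by its decay in time. -/
theorem exists_fderiv_mul_coneCutoff (hε : 0 < ε) {θ : ℝ → ℝ} (hθ : Differentiable ℝ θ)
    (hθ0 : ∀ t, 0 ≤ θ t) (p : EuclideanSpace ℝ (Fin n) × ℝ) :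
    ∃ (κ : ℝ) (ξ : EuclideanSpace ℝ (Fin n)), ‖ξ‖ ≤ κ ∧
      fderiv ℝ (fun p => θ p.2 * coneCutoff r L ε p) p (0, 1)
        = deriv θ p.2 * coneCutoff r L ε p - L * κ ∧
      ∀ i, fderiv ℝ (fun p => θ p.2 * coneCutoff r L ε p) p (EuclideanSpace.single i (1 : ℝ), 0)
        = ξ i := by
  set ρ : ℝ := √(‖p.1‖ ^ 2 + ε ^ 2) with hρ
  have hρ0 : 0 < ρ := by positivity
  set k : ℝ := deriv Real.smoothTransition ((r - (ρ + L * p.2)) / ε - 1) with hk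
  have hk0 : 0 ≤ k := Real.smoothTransition.monotone.deriv_nonneg
  have h1 : HasFDerivAt (fun p : EuclideanSpace ℝ (Fin n) × ℝ => √(‖p.1‖ ^ 2 + ε ^ 2)) _ p :=
    ((hasFDerivAt_fst.norm_sq).add_const _).sqrt (by positivity)
  have h2 : HasFDerivAt
      (fun p : EuclideanSpace ℝ (Fin n) × ℝ =>
        ε⁻¹ * (r - (√(‖p.1‖ ^ 2 + ε ^ 2) + L * p.2)) - 1) _ p :=
    ((((h1.add (hasFDerivAt_snd.const_mul L)).const_sub r).const_mul ε⁻¹).sub_const 1)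
  have h3 := ((Real.smoothTransition.contDiff (n := 1)).differentiable one_ne_zero
    (ε⁻¹ * (r - (ρ + L * p.2)) - 1)).hasDerivAt.comp_hasFDerivAt p h2
  have hsnd : HasFDerivAt (fun p : EuclideanSpace ℝ (Fin n) × ℝ => p.2)
      (ContinuousLinearMap.snd ℝ (EuclideanSpace ℝ (Fin n)) ℝ) p := hasFDerivAt_snd
  have h4 : HasFDerivAt (fun p : EuclideanSpace ℝ (Fin n) × ℝ => θ p.2) _ p :=
    (hθ p.2).hasDerivAt.comp_hasFDerivAt p hsnd
  have hcone : (coneCutoff r L ε : EuclideanSpace ℝ (Fin n) × ℝ → ℝ)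
      = Real.smoothTransition ∘ fun p : EuclideanSpace ℝ (Fin n) × ℝ =>
        ε⁻¹ * (r - (√(‖p.1‖ ^ 2 + ε ^ 2) + L * p.2)) - 1 := by
    ext p
    simp [coneCutoff, div_eq_inv_mul]
  rw [← hcone] at h3
  have h5 : HasFDerivAt (fun p => θ p.2 * coneCutoff r L ε p) _ p := h4.mul h3
  have hkey : deriv Real.smoothTransition (ε⁻¹ * (r - (ρ + L * p.2)) - 1) = k := by
    rw [hk, div_eq_inv_mul]
  refine ⟨θ p.2 * k / ε, (-(θ p.2 * k / ε / ρ)) • p.1, ?_, ?_, fun i => ?_⟩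
  · have h0 : 0 ≤ θ p.2 * k / ε := div_nonneg (mul_nonneg (hθ0 _) hk0) hε.le
    rw [norm_smul, norm_neg, Real.norm_of_nonneg (div_nonneg h0 hρ0.le), div_mul_eq_mul_div,
      div_le_iff₀ hρ0]
    exact mul_le_mul_of_nonneg_left (norm_le_sqrt_norm_sq_add_sq _ _) h0
  · rw [h5.fderiv, hkey]
    simp [coneCutoff]
    field_simp
    ring
  · rw [h5.fderiv, hkey]
    simp [coneCutoff, EuclideanSpace.inner_single_right]
    field_simp
    rw [← hρ]
    ring

theorem setIntegral_ball_mul_cone_indicator (hn : 1 ≤ n) (h : EuclideanSpace ℝ (Fin n) → ℝ)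
    {s : ℝ} (hs : 0 ≤ s) :
    ∫ x in Metric.ball (0 : EuclideanSpace ℝ (Fin n)) r, h x * (if ‖x‖ + s < r then 1 else 0)
      = ∫ x in Metric.closedBall (0 : EuclideanSpace ℝ (Fin n)) (r - s), h x := by
  have : Nonempty (Fin n) := ⟨⟨0, hn⟩⟩
  have hind : ∀ x, h x * (if ‖x‖ + s < r then 1 else 0)
      = (Metric.ball (0 : EuclideanSpace ℝ (Fin n)) (r - s)).indicator h x := by
    intro x
    by_cases hx : ‖x‖ + s < r
    · rw [indicator_of_mem (by simpa using lt_sub_iff_add_lt.2 hx), if_pos hx, mul_one]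
    · rw [indicator_of_notMem (by simpa using not_lt.1 hx), if_neg hx, mul_zero]
  simp_rw [hind]
  rw [setIntegral_indicator Metric.isOpen_ball.measurableSet,
    inter_eq_right.2 (Metric.ball_subset_ball (by linarith))]
  refine setIntegral_congr_set ?_
  refine ae_eq_of_subset_of_measure_ge Metric.ball_subset_closedBall ?_
    Metric.isOpen_ball.measurableSet.nullMeasurableSet ?_
  · rw [Measure.addHaar_closedBall_eq_addHaar_ball]
  · exact measure_closedBall_lt_top.ne

end Cone

theorem measurable_real_sign : Measurable Real.sign :=
  Measurable.ite measurableSet_Iio measurable_const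
    (Measurable.ite measurableSet_Ioi measurable_const measurable_const)

theorem abs_real_sign_le_one (x : ℝ) : |Real.sign x| ≤ 1 := by
  rcases Real.sign_apply_eq x with h | h | h <;> rw [h] <;> norm_num

/-- Pointwise form of the cancellation of the flux against the decay of the cone cut-off. -/
theorem entropy_density_le {d s Φ D q g L L' Cq κ θ' θ χ : ℝ} (hd : 0 ≤ d) (hs : |s| ≤ 1)
    (hΦ : |Φ| ≤ L * κ * d) (hD : |D| ≤ L' * d) (hq : |q| ≤ Cq) (hθ : 0 ≤ θ) (hχ : 0 ≤ χ) :
    (d * (θ' * χ - L * κ) + s * Φ - s * (D * (θ * χ)) + d * q * (θ * χ)) * g ^ 2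
      ≤ d * g ^ 2 * ((θ' + (Cq + L') * θ) * χ) := by
  have hφ : 0 ≤ θ * χ := mul_nonneg hθ hχ
  have h1 : s * Φ ≤ L * κ * d := by
    refine (le_abs_self _).trans ?_
    rw [abs_mul]
    exact (mul_le_of_le_one_left (abs_nonneg _) hs).trans hΦ
  have h2 : -(s * D) ≤ L' * d := by
    refine (neg_le_abs _).trans ?_
    rw [abs_mul]
    exact (mul_le_of_le_one_left (abs_nonneg _) hs).trans hD
  have h3 : d * q ≤ d * Cq := mul_le_mul_of_nonneg_left ((le_abs_self q).trans hq) hd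
  have h4 := mul_le_mul_of_nonneg_right h2 hφ
  have h5 := mul_le_mul_of_nonneg_right h3 hφ
  calc _ ≤ (d * ((θ' + (Cq + L') * θ) * χ)) * g ^ 2 :=
        mul_le_mul_of_nonneg_right (by linarith) (sq_nonneg g)
    _ = _ := by ring

end Auxiliary

/-- Finite speed of propagation / weighted `L¹`-contraction along the backward cone:
if the contracted Kruzkov inequality holds for all nonnegative Lipschitz test functions
compactly supported in `Ω_T`, then
`μ(τ₂) ≤ μ(τ₁) exp((‖q‖_∞ + L')(τ₂ − τ₁))` for Lebesgue points `τ₁ < τ₂` of `μ`,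
where `μ(t) = ∫_{S_t} |u − ū| G² dx` and `S_t` is the ball of radius `r − Lt`. -/
theorem weighted_L1_contraction {n : ℕ} (hn : 1 ≤ n) (r T : ℝ) (hr : 0 < r) (hT : 0 < T)
    (u ub : EuclideanSpace ℝ (Fin n) × ℝ → ℝ)
    (hu : Measurable u) (hub : Measurable ub)
    (M : ℝ)
    (hbdd : ∀ p ∈ (Metric.ball (0 : EuclideanSpace ℝ (Fin n)) r ×ˢ Set.Ioo 0 T),
      |u p| ≤ M ∧ |ub p| ≤ M)
    (qfun : EuclideanSpace ℝ (Fin n) × ℝ → ℝ) (hqmeas : Measurable qfun)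
    (Cq : ℝ)
    (hqbdd : ∀ p ∈ (closure (Metric.ball (0 : EuclideanSpace ℝ (Fin n)) r) ×ˢ Set.Icc 0 T),
      |qfun p| ≤ Cq)
    (G : EuclideanSpace ℝ (Fin n) × ℝ → ℝ) (KG : NNReal)
    (hG : LipschitzOnWith KG G
      (closure (Metric.ball (0 : EuclideanSpace ℝ (Fin n)) r) ×ˢ Set.Icc 0 T))
    (hGpos : ∀ p ∈ (closure (Metric.ball (0 : EuclideanSpace ℝ (Fin n)) r) ×ˢ Set.Icc 0 T),
      0 < G p)
    (f : EuclideanSpace ℝ (Fin n) → ℝ → ℝ → Fin n → ℝ)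
    (hf : ContDiffOn ℝ 1 (fun q : (EuclideanSpace ℝ (Fin n) × ℝ) × ℝ => f q.1.1 q.1.2 q.2)
      ((closure (Metric.ball (0 : EuclideanSpace ℝ (Fin n)) r) ×ˢ Set.Icc 0 T) ×ˢ
        (Set.univ : Set ℝ)))
    -- `L` bounds the Lipschitz speed `(Σ_i (∂_w f_i)²)^{1/2}` of the flux
    (L : ℝ) (hL : 0 ≤ L)
    (hLspeed : ∀ p ∈ (closure (Metric.ball (0 : EuclideanSpace ℝ (Fin n)) r) ×ˢ Set.Icc 0 T),
      ∀ w : ℝ, |w| ≤ M → ∑ i, (deriv (fun w' => f p.1 p.2 w' i) w) ^ 2 ≤ L ^ 2)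
    -- `L'` is a Lipschitz constant of `w ↦ Σ_i ∂_{x_i} f_i(x,t,w)` on `[-M,M]`
    (L' : ℝ) (hL' : 0 ≤ L')
    (hLip' : ∀ p ∈ (closure (Metric.ball (0 : EuclideanSpace ℝ (Fin n)) r) ×ˢ Set.Icc 0 T),
      ∀ a b : ℝ, |a| ≤ M → |b| ≤ M →
        |(∑ i, fderivWithin ℝ (fun y => f y p.2 a i)
              (closure (Metric.ball (0 : EuclideanSpace ℝ (Fin n)) r)) p.1
              (EuclideanSpace.single i (1 : ℝ)))
          - ∑ i, fderivWithin ℝ (fun y => f y p.2 b i)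
              (closure (Metric.ball (0 : EuclideanSpace ℝ (Fin n)) r)) p.1
              (EuclideanSpace.single i (1 : ℝ))| ≤ L' * |a - b|)
    -- contracted Kruzkov entropy inequality for nonnegative Lipschitz test functions
    (hentropy : ∀ φ : EuclideanSpace ℝ (Fin n) × ℝ → ℝ,
      (∃ Kφ : NNReal, LipschitzWith Kφ φ) → (∀ p, 0 ≤ φ p) → HasCompactSupport φ →
      tsupport φ ⊆ Metric.ball (0 : EuclideanSpace ℝ (Fin n)) r ×ˢ Set.Ioo 0 T →
      0 ≤ ∫ p in Metric.ball (0 : EuclideanSpace ℝ (Fin n)) r ×ˢ Set.Ioo 0 T,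
          (|u p - ub p| * fderiv ℝ φ p (0, 1)
            + Real.sign (u p - ub p) *
                ∑ i, (f p.1 p.2 (u p) i - f p.1 p.2 (ub p) i) *
                  fderiv ℝ φ p (EuclideanSpace.single i (1 : ℝ), 0)
            - Real.sign (u p - ub p) *
                ∑ i, (fderivWithin ℝ (fun y => f y p.2 (u p) i)
                        (closure (Metric.ball (0 : EuclideanSpace ℝ (Fin n)) r)) p.1
                        (EuclideanSpace.single i (1 : ℝ))
                      - fderivWithin ℝ (fun y => f y p.2 (ub p) i)
                          (closure (Metric.ball (0 : EuclideanSpace ℝ (Fin n)) r)) p.1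
                          (EuclideanSpace.single i (1 : ℝ))) * φ p
            + |u p - ub p| * qfun p * φ p)
          * (G p) ^ 2)
    -- the weighted L¹ distance over the shrinking balls S_t
    (μ : ℝ → ℝ)
    (hμ : ∀ t, μ t =
      ∫ x in Metric.closedBall (0 : EuclideanSpace ℝ (Fin n)) (r - L * t),
        |u (x, t) - ub (x, t)| * (G (x, t)) ^ 2) :
    ∀ τ₁ ∈ Set.Ioo (0 : ℝ) T, ∀ τ₂ ∈ Set.Ioo (0 : ℝ) T, τ₁ < τ₂ → 0 < r - L * τ₂ →
      IsLebesguePoint μ τ₁ → IsLebesguePoint μ τ₂ →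
      μ τ₂ ≤ μ τ₁ * Real.exp ((Cq + L') * (τ₂ - τ₁)) := by
  intro τ₁ hτ₁ τ₂ hτ₂ h₁₂ _ hLeb₁ hLeb₂
  set B := Metric.ball (0 : EuclideanSpace ℝ (Fin n)) r with hB
  set I := Set.Ioo (0 : ℝ) T with hI
  have hBm : MeasurableSet B := Metric.isOpen_ball.measurableSet
  have hΩm : MeasurableSet (B ×ˢ I) := hBm.prod measurableSet_Ioo
  have hsub : B ×ˢ I ⊆ closure B ×ˢ Set.Icc 0 T :=
    Set.prod_mono subset_closure Set.Ioo_subset_Icc_self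
  have hcl : IsCompact (closure B ×ˢ Set.Icc (0 : ℝ) T) :=
    (Metric.isBounded_ball.isCompact_closure).prod isCompact_Icc
  set ν : Measure (EuclideanSpace ℝ (Fin n) × ℝ) := volume.restrict (B ×ˢ I) with hν
  have hνfin : IsFiniteMeasure ν :=
    ⟨by
      rw [hν, Measure.restrict_apply_univ]
      exact (measure_mono hsub).trans_lt hcl.measure_lt_top⟩
  have hmem : ∀ᵐ p ∂ν, p ∈ B ×ˢ I := ae_restrict_mem hΩm
  have hdle : ∀ p ∈ B ×ˢ I, |u p - ub p| ≤ 2 * M := fun p hp => by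
    have := abs_sub (u p) (ub p)
    linarith [(hbdd p hp).1, (hbdd p hp).2]
  have hd : MemLp (fun p => |u p - ub p|) ⊤ ν :=
    memLp_top_of_bound (hu.sub hub).abs.aestronglyMeasurable (2 * M) <| by
      filter_upwards [hmem] with p hp
      rw [Real.norm_eq_abs, abs_abs]
      exact hdle p hp
  have hs : MemLp (fun p => Real.sign (u p - ub p)) ⊤ ν :=
    memLp_top_of_bound (measurable_real_sign.comp (hu.sub hub)).aestronglyMeasurable 1
      (ae_of_all _ fun p => abs_real_sign_le_one _)
  have hq : MemLp qfun ⊤ ν :=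
    memLp_top_of_bound hqmeas.aestronglyMeasurable Cq <| by
      filter_upwards [hmem] with p hp using hqbdd p (hsub hp)
  have hG2 : MemLp (fun p => G p ^ 2) ⊤ ν := by
    have hcont : ContinuousOn (fun p => G p ^ 2) (closure B ×ˢ Set.Icc 0 T) :=
      hG.continuousOn.pow 2
    obtain ⟨A, hA⟩ := hcl.exists_bound_of_continuousOn hcont
    exact memLp_top_of_bound (hcont.mono hsub |>.aestronglyMeasurable hΩm) A <| by
      filter_upwards [hmem] with p hp using hA p (hsub hp)
  have hflux : ∀ p ∈ B ×ˢ I, ∀ ξ : EuclideanSpace ℝ (Fin n),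
      |∑ i, (f p.1 p.2 (u p) i - f p.1 p.2 (ub p) i) * ξ i|
        ≤ L * ‖ξ‖ * |u p - ub p| := fun p hp ξ =>
    abs_sum_flux_sub_mul_le (g := fun w i => f p.1 p.2 w i) hL
      (fun i => differentiable_flux_apply hf (hsub hp) i) (hLspeed p (hsub hp))
      (hbdd p hp).1 (hbdd p hp).2 ξ
  have hfm : ∀ (i : Fin n) (v : EuclideanSpace ℝ (Fin n) × ℝ → ℝ), Measurable v →
      AEStronglyMeasurable (fun p => f p.1 p.2 (v p) i) ν := fun i v hv =>
    (contDiffOn_flux_apply hf i).continuousOn.aestronglyMeasurable_comp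
      (hcl.isClosed.measurableSet.prod MeasurableSet.univ) (measurable_id.prodMk hv) hΩm
      (fun p hp => ⟨hsub hp, Set.mem_univ _⟩) volume
  have hdfm : ∀ (i : Fin n) (v : EuclideanSpace ℝ (Fin n) × ℝ → ℝ), Measurable v →
      AEStronglyMeasurable (fun p => fderivWithin ℝ (fun y => f y p.2 (v p) i) (closure B) p.1
        (EuclideanSpace.single i (1 : ℝ))) ν := fun i v hv =>
    (continuousOn_fderivWithin_flux hf Metric.isOpen_ball isOpen_Ioo subset_closure
      Set.Ioo_subset_Icc_self i _).aestronglyMeasurable_comp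
      (hΩm.prod MeasurableSet.univ) (measurable_id.prodMk hv) hΩm
      (fun p hp => ⟨hp, Set.mem_univ _⟩) volume
  have hΔf : ∀ i, MemLp (fun p => f p.1 p.2 (u p) i - f p.1 p.2 (ub p) i) ⊤ ν := fun i =>
    memLp_top_of_bound ((hfm i u hu).sub (hfm i ub hub)) (L * (2 * M)) <| by
      filter_upwards [hmem] with p hp
      have h := hflux p hp (EuclideanSpace.single i 1)
      simp only [PiLp.single_apply, mul_ite, mul_one, mul_zero, Finset.sum_ite_eq',
        Finset.mem_univ, if_true, PiLp.norm_single, norm_one] at h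
      exact h.trans (mul_le_mul_of_nonneg_left (hdle p hp) hL)
  set D : EuclideanSpace ℝ (Fin n) × ℝ → ℝ := fun p =>
    ∑ i, (fderivWithin ℝ (fun y => f y p.2 (u p) i) (closure B) p.1
        (EuclideanSpace.single i (1 : ℝ))
      - fderivWithin ℝ (fun y => f y p.2 (ub p) i) (closure B) p.1
        (EuclideanSpace.single i (1 : ℝ))) with hDdef
  have hDle : ∀ p ∈ B ×ˢ I, |D p| ≤ L' * |u p - ub p| := fun p hp => by
    simp only [hDdef, Finset.sum_sub_distrib]
    exact hLip' p (hsub hp) _ _ (hbdd p hp).1 (hbdd p hp).2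
  have hD : MemLp D ⊤ ν :=
    memLp_top_of_bound
      (Finset.aestronglyMeasurable_fun_sum _ fun i _ => (hdfm i u hu).sub (hdfm i ub hub))
      (L' * (2 * M)) <| by
      filter_upwards [hmem] with p hp
      exact (hDle p hp).trans (mul_le_mul_of_nonneg_left (hdle p hp) hL')
  have hW : MemLp (fun p => |u p - ub p| * G p ^ 2) ⊤ ν := hG2.mul' hd
  have hprod : ν = (volume.restrict B).prod (volume.restrict I) := by
    rw [Measure.prod_restrict, hν, Measure.volume_eq_prod]
  set cone : EuclideanSpace ℝ (Fin n) × ℝ → ℝ := fun p => if ‖p.1‖ + L * p.2 < r then 1 else 0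
    with hcone
  have hconem : MemLp cone ⊤ ν := by
    refine memLp_top_of_bound (Measurable.aestronglyMeasurable ?_) 1 (ae_of_all _ fun p => ?_)
    · exact Measurable.ite (measurableSet_lt (by fun_prop) measurable_const) measurable_const
        measurable_const
    · simp only [hcone]
      split_ifs <;> simp
  have hslice : ∀ t ∈ I, ∫ x in B, |u (x, t) - ub (x, t)| * G (x, t) ^ 2 * cone (x, t) = μ t :=
    fun t ht => by
      rw [hμ t]
      exact setIntegral_ball_mul_cone_indicator hn
        (fun x => |u (x, t) - ub (x, t)| * G (x, t) ^ 2) (mul_nonneg hL ht.1.le)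
  have hWcone : Integrable (fun p => |u p - ub p| * G p ^ 2 * cone p)
      ((volume.restrict B).prod (volume.restrict I)) :=
    hprod ▸ (MemLp.mul' (r := ⊤) hconem hW).integrable le_top
  have hμint : IntegrableOn μ I := by
    refine hWcone.integral_prod_right.congr ?_
    filter_upwards [ae_restrict_mem measurableSet_Ioo] with t ht using hslice t ht
  refine le_mul_exp_of_forall_integral_nonneg hμint hτ₁ hτ₂ h₁₂.le hLeb₁ hLeb₂ ?_
  intro θ hθ hθ0 hθc hθs
  have hθ' : Continuous (deriv θ) := hθ.continuous_deriv le_rfl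
  have hψc : Continuous fun t => deriv θ t + (Cq + L') * θ t :=
    hθ'.add (continuous_const.mul hθ.continuous)
  have hψ : MemLp (fun p : EuclideanSpace ℝ (Fin n) × ℝ =>
      deriv θ p.2 + (Cq + L') * θ p.2) ⊤ ν := by
    obtain ⟨A, hA⟩ := (isCompact_Icc (a := (0 : ℝ)) (b := T)).exists_bound_of_continuousOn
      hψc.continuousOn
    exact memLp_top_of_bound (hψc.comp continuous_snd).aestronglyMeasurable A <| by
      filter_upwards [hmem] with p hp using hA p.2 (Set.Ioo_subset_Icc_self hp.2)
  have hχ : ∀ ε, 0 < ε → MemLp (coneCutoff r L ε) ⊤ ν := fun ε hε =>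
    memLp_top_of_bound (contDiff_coneCutoff hε).continuous.aestronglyMeasurable 1
      (ae_of_all _ fun p => by
        rw [Real.norm_of_nonneg (coneCutoff_nonneg p)]
        exact coneCutoff_le_one p)
  have hcut : ∀ ε, 0 < ε → MemLp (fun p => |u p - ub p| * G p ^ 2 *
      ((deriv θ p.2 + (Cq + L') * θ p.2) * coneCutoff r L ε p)) ⊤ ν := fun ε hε => by
    have h : MemLp (fun p => (deriv θ p.2 + (Cq + L') * θ p.2) * coneCutoff r L ε p) ⊤ ν :=
      (hχ ε hε).mul' hψ
    exact h.mul' hW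
  have hstep : ∀ ε, 0 < ε → 0 ≤ ∫ p, |u p - ub p| * G p ^ 2 *
      ((deriv θ p.2 + (Cq + L') * θ p.2) * coneCutoff r L ε p) ∂ν := by
    intro ε hε
    set φ : EuclideanSpace ℝ (Fin n) × ℝ → ℝ := fun p => θ p.2 * coneCutoff r L ε p with hφ
    have hφd : ContDiff ℝ 1 φ := (hθ.comp contDiff_snd).mul (contDiff_coneCutoff hε)
    have hsupp : Function.support φ ⊆
        Metric.closedBall (0 : EuclideanSpace ℝ (Fin n)) (r - ε) ×ˢ tsupport θ := by
      intro p hp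
      have hp2 : p.2 ∈ tsupport θ := subset_tsupport θ (left_ne_zero_of_mul hp)
      refine ⟨?_, hp2⟩
      rw [mem_closedBall_zero_iff]
      linarith [norm_add_lt_of_coneCutoff_ne_zero hε (right_ne_zero_of_mul hp),
        mul_nonneg hL (hθs hp2).1.le]
    have hKc : IsCompact (Metric.closedBall (0 : EuclideanSpace ℝ (Fin n)) (r - ε) ×ˢ tsupport θ) :=
      (isCompact_closedBall _ _).prod hθc
    have hφc : HasCompactSupport φ := HasCompactSupport.of_support_subset_isCompact hKc hsupp
    have hφs : tsupport φ ⊆ B ×ˢ I :=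
      (closure_minimal hsupp hKc.isClosed).trans
        (Set.prod_mono (Metric.closedBall_subset_ball (by linarith)) hθs)
    obtain ⟨Kφ, hKφ⟩ := hφd.lipschitzWith_of_hasCompactSupport hφc one_ne_zero
    have hφ0 : ∀ p, 0 ≤ φ p := fun p => mul_nonneg (hθ0 _) (coneCutoff_nonneg p)
    have hφm : MemLp φ ⊤ ν := by
      obtain ⟨A, hA⟩ := hφc.exists_bound_of_continuous hφd.continuous
      exact memLp_top_of_bound hφd.continuous.aestronglyMeasurable A (ae_of_all _ hA)
    have hdφ : ∀ v, MemLp (fun p => fderiv ℝ φ p v) ⊤ ν := fun v =>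
      memLp_top_of_bound
        ((hφd.continuous_fderiv one_ne_zero).clm_apply continuous_const).aestronglyMeasurable
        (Kφ * ‖v‖) (ae_of_all _ fun p => (fderiv ℝ φ p).le_of_opNorm_le
          (norm_fderiv_le_of_lipschitz ℝ hKφ) v)
    refine (hentropy φ ⟨Kφ, hKφ⟩ hφ0 hφc hφs).trans ?_
    simp only [← Finset.sum_mul]
    refine setIntegral_mono_on ?_ ?_ hΩm fun p hp => ?_
    · have htime : MemLp (fun p => |u p - ub p| * fderiv ℝ φ p (0, 1)) ⊤ ν := (hdφ (0, 1)).mul' hd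
      have hsum : MemLp (fun p => ∑ i, (f p.1 p.2 (u p) i - f p.1 p.2 (ub p) i) *
          fderiv ℝ φ p (EuclideanSpace.single i (1 : ℝ), 0)) ⊤ ν :=
        memLp_finsetSum Finset.univ fun i _ => (hdφ (EuclideanSpace.single i 1, 0)).mul' (hΔf i)
      have hspace : MemLp (fun p => Real.sign (u p - ub p) *
          ∑ i, (f p.1 p.2 (u p) i - f p.1 p.2 (ub p) i) *
            fderiv ℝ φ p (EuclideanSpace.single i (1 : ℝ), 0)) ⊤ ν := hsum.mul' hs
      have hdiv : MemLp (fun p => D p * φ p) ⊤ ν := hφm.mul' hD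
      have hsource : MemLp (fun p => Real.sign (u p - ub p) * (D p * φ p)) ⊤ ν := hdiv.mul' hs
      have hqd : MemLp (fun p => |u p - ub p| * qfun p) ⊤ ν := hq.mul' hd
      have hreact : MemLp (fun p => |u p - ub p| * qfun p * φ p) ⊤ ν := hφm.mul' hqd
      exact (MemLp.mul' (p := ⊤) (q := ⊤) (r := ⊤) hG2
        (((htime.add hspace).sub hsource).add hreact)).integrable le_top
    · exact (hcut ε hε).integrable le_top
    · obtain ⟨κ, ξ, hξ, hφt, hφx⟩ := exists_fderiv_mul_coneCutoff (r := r) (L := L) hε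
        (hθ.differentiable one_ne_zero) hθ0 p
      rw [← hφ] at hφt hφx
      simp only [hφt, hφx]
      refine entropy_density_le (abs_nonneg _) (abs_real_sign_le_one _)
        ((hflux p hp ξ).trans ?_) (hDle p hp) (hqbdd p (hsub hp)) (hθ0 _) (coneCutoff_nonneg p)
      gcongr
  have hWψ : MemLp (fun p => |u p - ub p| * G p ^ 2 * (deriv θ p.2 + (Cq + L') * θ p.2)) ⊤ ν :=
    hψ.mul' hW
  have hlim : Filter.Tendsto (fun ε => ∫ p, |u p - ub p| * G p ^ 2 *
      ((deriv θ p.2 + (Cq + L') * θ p.2) * coneCutoff r L ε p) ∂ν) (nhdsWithin 0 (Set.Ioi 0))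
      (nhds (∫ p, |u p - ub p| * G p ^ 2 *
        ((deriv θ p.2 + (Cq + L') * θ p.2) * cone p) ∂ν)) := by
    refine tendsto_integral_filter_of_dominated_convergence
      (fun p => ‖|u p - ub p| * G p ^ 2 * (deriv θ p.2 + (Cq + L') * θ p.2)‖) ?_ ?_
      (hWψ.integrable le_top).norm (ae_of_all _ fun p => ?_)
    · filter_upwards [self_mem_nhdsWithin] with ε hε
      exact (hcut ε hε).aestronglyMeasurable
    · refine Filter.Eventually.of_forall fun ε => ae_of_all _ fun p => ?_
      rw [← mul_assoc, norm_mul, Real.norm_of_nonneg (coneCutoff_nonneg p)]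
      exact mul_le_of_le_one_right (norm_nonneg _) (coneCutoff_le_one p)
    · exact ((tendsto_coneCutoff p).const_mul _).const_mul _
  have hnonneg := ge_of_tendsto hlim (Filter.eventually_of_mem self_mem_nhdsWithin hstep)
  have hψcone : MemLp (fun p => (deriv θ p.2 + (Cq + L') * θ p.2) * cone p) ⊤ ν := hconem.mul' hψ
  have hWψcone : MemLp (fun p => |u p - ub p| * G p ^ 2 *
      ((deriv θ p.2 + (Cq + L') * θ p.2) * cone p)) ⊤ ν := hψcone.mul' hW
  rw [hprod, integral_prod_symm _ (hprod ▸ hWψcone.integrable le_top)]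
    at hnonneg
  refine hnonneg.trans_eq (setIntegral_congr_fun measurableSet_Ioo fun t ht => ?_)
  beta_reduce
  rw [← hslice t ht, ← integral_const_mul]
  congr 1
  ext x
  ring
end
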